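/- Let K be a field of characteristic not 2, let n ≥ 3, and let f(x,y) = f₀xⁿ + ⋯ + f_nyⁿ be a binary form of degree n over K with f₀ ≠ 0 and f(x,1) separable of degree n. Consider the action of SL_n(K) on pairs (A,B) of n×n symmetric matrices over K by g·(A,B) = (gAgᵀ, gBgᵀ). Then there is a bijection between the set of SL_n(K)-orbits of pairs (A,B) whose invariant binary form equals f(x,y), and the quotient of the set {(α,s) ∈ L^× × K^× : N_{L/K}(α) = s²·f₀^{n−3}} by the equivalence relation identifying (α,s) with (c²α, N_{L/K}(c)·s) for every c ∈ L^×. -/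

import Mathlib

open Polynomial Matrix

noncomputable def binForm {n : ℕ} {R : Type*} [CommRing R] (f : Fin (n+1) → R) :
    MvPolynomial (Fin 2) R :=
  ∑ i : Fin (n+1), MvPolynomial.C (f i) * MvPolynomial.X 0 ^ (n - (i:ℕ)) * MvPolynomial.X 1 ^ (i:ℕ)

noncomputable def pencilDisc {m : Type*} [Fintype m] [DecidableEq m] {R : Type*} [CommRing R]
    (A B : Matrix m m R) : MvPolynomial (Fin 2) R :=
  (-1) ^ (Fintype.card m * (Fintype.card m - 1) / 2) *
    Matrix.det (Matrix.of fun i j =>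
      MvPolynomial.X (0 : Fin 2) * MvPolynomial.C (A i j) - MvPolynomial.X (1 : Fin 2) * MvPolynomial.C (B i j))

noncomputable def fxOne {n : ℕ} {R : Type*} [CommRing R] (f : Fin (n+1) → R) : R[X] :=
  ∑ i : Fin (n+1), C (f i) * X ^ (n - (i:ℕ))

noncomputable abbrev Lf {n : ℕ} {K : Type*} [Field K] (f : Fin (n+1) → K) :=
  AdjoinRoot (C (f 0)⁻¹ * fxOne f)


/-- The orbit relation for the action of `SL_n(K)` on pairs of symmetric matrices
with invariant binary form `f`. -/
def orbitRel {n : ℕ} (K : Type*) [Field K] (f : Fin (n+1) → K)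
    (p q : {AB : Matrix (Fin n) (Fin n) K × Matrix (Fin n) (Fin n) K //
      AB.1.IsSymm ∧ AB.2.IsSymm ∧ pencilDisc AB.1 AB.2 = binForm f}) : Prop :=
  ∃ γ : Matrix.SpecialLinearGroup (Fin n) K,
    q.1.1 = (γ : Matrix (Fin n) (Fin n) K) * p.1.1 * (γ : Matrix (Fin n) (Fin n) K)ᵀ ∧
    q.1.2 = (γ : Matrix (Fin n) (Fin n) K) * p.1.2 * (γ : Matrix (Fin n) (Fin n) K)ᵀ

/-- The relation identifying `(α, s)` with `(c²α, N_{L/K}(c)·s)` for `c ∈ L^×`. -/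
def pairRel {n : ℕ} (K : Type*) [Field K] (f : Fin (n+1) → K)
    (a b : {as : Lf f × K // IsUnit as.1 ∧ as.2 ≠ 0 ∧
      Algebra.norm K as.1 = as.2 ^ 2 * (f 0) ^ (n - 3)}) : Prop :=
  ∃ c : Lf f, IsUnit c ∧ b.1.1 = c ^ 2 * a.1.1 ∧ b.1.2 = Algebra.norm K c * a.1.2


theorem Matrix.det_of_antitriangular {R : Type*} [CommRing R] : ∀ (n : ℕ)
    (N : Matrix (Fin n) (Fin n) R), (∀ i j : Fin n, (i : ℕ) + j + 1 < n → N i j = 0) →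
    (∀ i j : Fin n, (i : ℕ) + j + 1 = n → N i j = 1) → N.det = (-1) ^ (n * (n - 1) / 2)
  | 0, N, _, _ => by simp
  | n + 1, N, h0, h1 => by
    have key : (n + 1) * (n + 1 - 1) / 2 = n + n * (n - 1) / 2 := by
      rw [← Nat.choose_two_right, ← Nat.choose_two_right, Nat.choose_succ_succ' n 1,
        Nat.choose_one_right]
    rw [Matrix.det_succ_row_zero, Finset.sum_eq_single (Fin.last n)]
    · rw [h1 0 (Fin.last n) (by simp), key, pow_add,
        Matrix.det_of_antitriangular n (N.submatrix Fin.succ (Fin.last n).succAbove)]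
      · simp
      · intro i j hij
        exact h0 _ _ (by simp; omega)
      · intro i j hij
        exact h1 _ _ (by simp; omega)
    · intro j _ hj
      have : (j : ℕ) < n := lt_of_le_of_ne (Nat.le_of_lt_succ j.2)
        (fun h => hj (Fin.ext (by simpa using h)))
      rw [h0 0 j (by simp; omega)]
      simp
    · simp

theorem Matrix.det_aeval_eq_zero_of_irreducible_dvd_charpoly {K m : Type*} [Field K] [Fintype m]
    [DecidableEq m] {T : Matrix m m K} {p : K[X]} (hp : Irreducible p) (hdvd : p ∣ T.charpoly) :
    (aeval T p).det = 0 := by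
  have : Fact (Irreducible p) := ⟨hp⟩
  set φ := algebraMap K (AdjoinRoot p)
  set a := AdjoinRoot.root p
  have ha : (p.map φ).IsRoot a := by
    rw [IsRoot, eval_map_algebraMap, AdjoinRoot.aeval_eq, AdjoinRoot.mk_self]
  have hchar : (scalar m a - T.map φ).det = 0 := by
    rw [← Matrix.eval_charpoly, Matrix.charpoly_map]
    exact ha.dvd (Polynomial.map_dvd φ hdvd)
  obtain ⟨q, hq⟩ := dvd_iff_isRoot.2 ha
  apply φ.injective
  rw [map_zero, RingHom.map_det]
  have h : φ.mapMatrix (aeval T p) = aeval (T.map φ) (p.map φ) := by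
    have := Polynomial.map_aeval_eq_aeval_map (φ := φ) (ψ := φ.mapMatrix (m := m))
      (by ext r i j; simp [Matrix.algebraMap_matrix_apply, apply_ite φ]) p T
    simpa using this
  have h2 : aeval (T.map φ) (X - C a) = -(scalar m a - T.map φ) := by
    simp [Matrix.scalar, Matrix.algebraMap_eq_diagonal, Pi.algebraMap_def]
  rw [h, hq, map_mul, det_mul, h2, det_neg, hchar]
  simp

/-- A matrix with squarefree characteristic polynomial has a cyclic vector. -/
theorem Matrix.exists_cyclic_vector {K m : Type*} [Field K] [Fintype m]
    [DecidableEq m] {T : Matrix m m K} (hT : Squarefree T.charpoly) :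
    ∃ v : m → K, ∀ q : K[X], aeval T q *ᵥ v = 0 → T.charpoly ∣ q := by
  suffices H : ∀ g : K[X], g ∣ T.charpoly →
      ∃ v : m → K, aeval T g *ᵥ v = 0 ∧ ∀ q : K[X], aeval T q *ᵥ v = 0 → g ∣ q from
    (H _ dvd_rfl).imp fun v hv => hv.2
  intro g
  induction g using UniqueFactorizationMonoid.induction_on_prime with
  | h₁ => exact fun h => absurd (zero_dvd_iff.1 h) T.charpoly_monic.ne_zero
  | h₂ x hx => exact fun _ => ⟨0, by simp, fun q _ => hx.dvd⟩
  | h₃ k p hk hp ih =>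
    intro hdvd
    obtain ⟨v, hv, hv'⟩ := ih ((dvd_mul_left k p).trans hdvd)
    obtain ⟨w, hw0, hw⟩ := Matrix.exists_mulVec_eq_zero_iff.2
      (Matrix.det_aeval_eq_zero_of_irreducible_dvd_charpoly hp.irreducible
        ((dvd_mul_right p k).trans hdvd))
    have hcop : IsCoprime p k := by
      rw [hp.irreducible.coprime_iff_not_dvd]
      rintro ⟨r, rfl⟩
      exact hp.not_isUnit (hT p ((Dvd.intro r (by ring)).trans hdvd))
    have hann : ∀ q : K[X], aeval T q *ᵥ w = 0 → p ∣ q := by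
      intro q hq
      by_contra hpq
      obtain ⟨a, b, hab⟩ := (hp.irreducible.coprime_iff_not_dvd).2 hpq
      apply hw0
      have : aeval T (a * p + b * q) *ᵥ w = w := by rw [hab]; simp
      rw [← this, map_add, map_mul, map_mul, Matrix.add_mulVec, ← Matrix.mulVec_mulVec,
        ← Matrix.mulVec_mulVec, hw, hq]
      simp
    refine ⟨v + w, ?_, fun q hq => ?_⟩
    · rw [Matrix.mulVec_add]
      nth_rewrite 2 [mul_comm]
      rw [map_mul, map_mul, ← Matrix.mulVec_mulVec, ← Matrix.mulVec_mulVec, hv, hw]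
      simp
    · have h1 : p ∣ k * q := by
        apply hann
        have : aeval T (k * q) *ᵥ (v + w) = 0 := by
          rw [map_mul, ← Matrix.mulVec_mulVec, hq, Matrix.mulVec_zero]
        rw [Matrix.mulVec_add] at this
        nth_rewrite 1 [mul_comm] at this
        rwa [map_mul, ← Matrix.mulVec_mulVec v, hv, Matrix.mulVec_zero, zero_add] at this
      have h2 : k ∣ p * q := by
        apply hv'
        have : aeval T (p * q) *ᵥ (v + w) = 0 := by
          rw [map_mul, ← Matrix.mulVec_mulVec, hq, Matrix.mulVec_zero]
        rw [Matrix.mulVec_add] at this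
        nth_rewrite 2 [mul_comm] at this
        rwa [map_mul _ q p, ← Matrix.mulVec_mulVec w, hw, Matrix.mulVec_zero, add_zero] at this
      exact hcop.mul_dvd (hcop.dvd_of_dvd_mul_left h1) (hcop.symm.dvd_of_dvd_mul_left h2)

theorem binForm_eq_homogenize {n : ℕ} {R : Type*} [CommRing R] (f : Fin (n + 1) → R) :
    binForm f = (fxOne f).homogenize n := by
  refine (homogenize_eq_of_isHomogeneous ?_ ?_).symm
  · refine MvPolynomial.IsHomogeneous.sum _ _ _ fun i _ => ?_
    have := ((MvPolynomial.isHomogeneous_C (Fin 2) (f i)).mul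
      (MvPolynomial.isHomogeneous_X_pow (R := R) (0 : Fin 2) (n - (i : ℕ)))).mul
      (MvPolynomial.isHomogeneous_X_pow (1 : Fin 2) (i : ℕ))
    convert this using 1
    omega
  · simp [binForm, fxOne, MvPolynomial.algHom_C]

theorem pencilDisc_eq_homogenize {n : ℕ} {R : Type*} [CommRing R] (A B : Matrix (Fin n) (Fin n) R) :
    pencilDisc A B = ((-1) ^ (n * (n - 1) / 2) *
      ((X : R[X]) • A.map C - B.map C).det).homogenize n := by
  refine (homogenize_eq_of_isHomogeneous ?_ ?_).symm
  · rw [pencilDisc, Matrix.det_apply, Fintype.card_fin,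
      show (-1 : MvPolynomial (Fin 2) R) = MvPolynomial.C (-1) by simp, ← map_pow]
    refine (MvPolynomial.IsHomogeneous.sum _ _ _ fun σ _ => ?_).C_mul _
    rw [Units.smul_def, zsmul_eq_mul, ← map_intCast (MvPolynomial.C (R := R) (σ := Fin 2))]
    refine MvPolynomial.IsHomogeneous.C_mul ?_ _
    convert MvPolynomial.IsHomogeneous.prod Finset.univ _ (fun _ : Fin n => 1) fun i _ => ?_
    · simp
    · exact ((MvPolynomial.isHomogeneous_X R _).mul (MvPolynomial.isHomogeneous_C _ _)).sub
        ((MvPolynomial.isHomogeneous_X R _).mul (MvPolynomial.isHomogeneous_C _ _))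
  · rw [pencilDisc, map_mul, AlgHom.map_det]
    congr 1
    · simp
    · congr 1
      ext1 i j
      simp [MvPolynomial.algHom_C]

theorem natDegree_fxOne_le {n : ℕ} {R : Type*} [CommRing R] (f : Fin (n + 1) → R) :
    (fxOne f).natDegree ≤ n :=
  natDegree_sum_le_of_forall_le _ _ fun i _ => (natDegree_C_mul_X_pow_le _ _).trans (by omega)

theorem natDegree_det_pencil_le {n : ℕ} {R : Type*} [CommRing R] (A B : Matrix (Fin n) (Fin n) R) :
    ((-1) ^ (n * (n - 1) / 2) * ((X : R[X]) • A.map C - B.map C).det).natDegree ≤ n := by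
  have h := natDegree_det_X_add_C_le A (-B)
  rw [Fintype.card_fin] at h
  rw [show (-1 : R[X]) = C (-1) by simp, ← map_pow]
  refine (natDegree_C_mul_le _ _).trans (le_trans (le_of_eq ?_) h)
  congr 2
  ext1 i j
  simp [sub_eq_add_neg]

theorem pencilDisc_eq_binForm_iff {n : ℕ} {R : Type*} [CommRing R]
    (A B : Matrix (Fin n) (Fin n) R) (f : Fin (n + 1) → R) :
    pencilDisc A B = binForm f ↔
      (-1) ^ (n * (n - 1) / 2) * ((X : R[X]) • A.map C - B.map C).det = fxOne f := by
  rw [binForm_eq_homogenize, pencilDisc_eq_homogenize]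
  refine ⟨fun h => ?_, fun h => by rw [h]⟩
  rw [← aeval_homogenize_X_one (fxOne f) (natDegree_fxOne_le f), ← h,
    aeval_homogenize_X_one _ (natDegree_det_pencil_le A B)]

theorem exists_symm_gram {K L : Type*} [CommRing K] [CommRing L] [Algebra K L] {n : ℕ} (hn : 0 < n)
    (b : Module.Basis (Fin n) K L) (θ : L) (hb : ∀ i, b i = θ ^ (i : ℕ)) :
    ∃ J : Matrix (Fin n) (Fin n) K, Jᵀ = J ∧ J.det = (-1) ^ (n * (n - 1) / 2) ∧
      ∀ x, J * Algebra.leftMulMatrix b x = (Algebra.leftMulMatrix b x)ᵀ * J := by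
  set τ := b.coord ⟨n - 1, by omega⟩ with hτ
  have hJ (x : L) : (of fun i j => τ (b i * b j)) * Algebra.leftMulMatrix b x =
      of fun i j => τ (b i * (x * b j)) := by
    ext i j
    rw [Matrix.mul_apply, of_apply]
    conv_rhs => rw [← b.sum_repr (x * b j), Finset.mul_sum, map_sum]
    refine Finset.sum_congr rfl fun k _ => ?_
    rw [mul_smul_comm, map_smul, Algebra.leftMulMatrix_eq_repr_mul, of_apply, smul_eq_mul, mul_comm]
  have hsymm : (of fun i j => τ (b i * b j))ᵀ = of fun i j => τ (b i * b j) := by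
    ext i j
    simp [mul_comm]
  refine ⟨of fun i j => τ (b i * b j), hsymm, ?_, fun x => ?_⟩
  · have h (i j : Fin n) (k : Fin n) (hk : (i : ℕ) + j = k) :
        τ (b i * b j) = if (k : ℕ) = n - 1 then 1 else 0 := by
      rw [hb, hb, ← pow_add, hk, ← hb, hτ, Module.Basis.coord_apply, b.repr_self,
        Finsupp.single_apply]
      simp [Fin.ext_iff]
    apply Matrix.det_of_antitriangular
    · intro i j hij
      rw [of_apply, h i j ⟨i + j, by omega⟩ rfl, if_neg (by simp; omega)]
    · intro i j hij
      rw [of_apply, h i j ⟨i + j, by omega⟩ rfl, if_pos (by simp; omega)]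
  · conv_rhs => rw [← hsymm]
    rw [← Matrix.transpose_mul, hJ]
    ext i j
    simp only [of_apply, transpose_apply]
    congr 1
    ring

theorem exists_eq_leftMulMatrix_of_commute {K L : Type*} [CommRing K] [CommRing L] [Algebra K L]
    {n : ℕ} (b : Module.Basis (Fin n) K L) (θ : L) (hb : ∀ i, b i = θ ^ (i : ℕ))
    {Y : Matrix (Fin n) (Fin n) K} (hY : Commute Y (Algebra.leftMulMatrix b θ)) :
    ∃ c, Y = Algebra.leftMulMatrix b c := by
  set φ := Matrix.toLin b b Y with hφ
  have hcomm (x : L) : φ (θ * x) = θ * φ x := by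
    have h := congrArg (Matrix.toLin b b) hY.eq
    rw [Matrix.toLin_mul b b b, Matrix.toLin_mul b b b, Algebra.leftMulMatrix_apply,
      Matrix.toLin_toMatrix] at h
    exact LinearMap.congr_fun h x
  have hpow (k : ℕ) : φ (θ ^ k) = φ 1 * θ ^ k := by
    induction k with
    | zero => simp
    | succ k ih => rw [pow_succ', hcomm, ih]; ring
  refine ⟨φ 1, ?_⟩
  rw [Algebra.leftMulMatrix_apply, ← LinearMap.toMatrix_toLin b b Y]
  congr 1
  refine b.ext fun i => ?_
  rw [← hφ, hb, hpow]
  rfl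

theorem Matrix.exists_intertwine_adjoinRoot {K : Type*} [Field K] {n : ℕ} {g : K[X]}
    (b : Module.Basis (Fin n) K (AdjoinRoot g)) {T : Matrix (Fin n) (Fin n) K}
    (hT : T.charpoly = g) (hg : Squarefree g) :
    ∃ Q : Matrix (Fin n) (Fin n) K, Q.det ≠ 0 ∧
      Q * Algebra.leftMulMatrix b (AdjoinRoot.root g) = T * Q := by
  obtain ⟨v, hv⟩ := Matrix.exists_cyclic_vector (T := T) (by rwa [hT])
  let ψ : AdjoinRoot g →ₗ[K] Matrix (Fin n) (Fin n) K :=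
    { toFun := fun x => aeval T (AdjoinRoot.modByMonicHom (hT ▸ T.charpoly_monic) x)
      map_add' := by simp
      map_smul' := by simp }
  have hψ (q : K[X]) : ψ (AdjoinRoot.mk g q) = aeval T q := by
    change aeval T (AdjoinRoot.modByMonicHom _ (AdjoinRoot.mk g q)) = _
    rw [AdjoinRoot.modByMonicHom_mk]
    conv_rhs => rw [← modByMonic_add_div q g, map_add, map_mul]
    rw [← hT, Matrix.aeval_self_charpoly, zero_mul, add_zero]
  let φ : AdjoinRoot g →ₗ[K] (Fin n → K) :=
    { toFun := fun x => ψ x *ᵥ v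
      map_add' := by simp [Matrix.add_mulVec]
      map_smul' := by simp [Matrix.smul_mulVec] }
  have hφ (q : K[X]) : φ (AdjoinRoot.mk g q) = aeval T q *ᵥ v := congrArg (· *ᵥ v) (hψ q)
  refine ⟨LinearMap.toMatrix b (Pi.basisFun K (Fin n)) φ, ?_, ?_⟩
  · intro hdet
    obtain ⟨w, hw, hw0⟩ := Matrix.exists_mulVec_eq_zero_iff.2 hdet
    apply hw
    obtain ⟨x, rfl⟩ := b.equivFun.surjective w
    have h := LinearMap.toMatrix_mulVec_repr b (Pi.basisFun K (Fin n)) φ x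
    rw [Module.Basis.equivFun_apply, h] at hw0
    obtain ⟨q, rfl⟩ := AdjoinRoot.mk_surjective x
    have hq : aeval T q *ᵥ v = 0 := by
      rw [← hφ]
      ext i
      simpa using congrFun hw0 i
    rw [AdjoinRoot.mk_eq_zero.2 (hT ▸ hv q hq), map_zero]
  · have hc : φ ∘ₗ Algebra.lmul K _ (AdjoinRoot.root g) = Matrix.toLin' T ∘ₗ φ := by
      ext x : 1
      obtain ⟨q, rfl⟩ := AdjoinRoot.mk_surjective x
      simp only [LinearMap.comp_apply, Matrix.toLin'_apply, hφ]
      change φ (AdjoinRoot.mk g X * AdjoinRoot.mk g q) = _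
      rw [← map_mul, hφ, map_mul, aeval_X, Matrix.mulVec_mulVec]
    rw [Algebra.leftMulMatrix_apply, ← LinearMap.toMatrix_comp, hc,
      LinearMap.toMatrix_comp b (Pi.basisFun K (Fin n)) (Pi.basisFun K (Fin n))]
    congr 1
    exact LinearMap.toMatrix'_toLin' T

section Gram

variable {K L : Type*} [Field K] [CommRing L] [Algebra K L] {n : ℕ}
  {b : Module.Basis (Fin n) K L} {θ : L} {J : Matrix (Fin n) (Fin n) K}

local notation "μ" => Algebra.leftMulMatrix b

theorem exists_sq_mul_eq_of_congr_gram (hb : ∀ i, b i = θ ^ (i : ℕ)) (hJdet : J.det ≠ 0)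
    (hJ : ∀ x, J * μ x = (μ x)ᵀ * J) {β β' : L} (hβ : (μ β).det ≠ 0)
    {R : Matrix (Fin n) (Fin n) K} (hR : R.det ≠ 0) (h₁ : R * (J * μ β) * Rᵀ = J * μ β')
    (h₂ : R * (J * μ (θ * β)) * Rᵀ = J * μ (θ * β')) :
    ∃ c, R = (μ c)ᵀ ∧ β' = c ^ 2 * β := by
  have hcomm : Commute Rᵀ (μ θ) := by
    have hU : IsUnit (R * (J * μ β)) := by
      rw [Matrix.isUnit_iff_isUnit_det, det_mul, det_mul]
      exact (mul_ne_zero hR (mul_ne_zero hJdet hβ)).isUnit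
    apply hU.mul_left_cancel
    rw [← mul_assoc, h₁, mul_assoc, ← map_mul, mul_comm β', ← h₂, mul_comm θ, map_mul]
    simp only [mul_assoc]
  obtain ⟨c, hc⟩ := exists_eq_leftMulMatrix_of_commute b θ hb hcomm
  have hRc : R = (μ c)ᵀ := by rw [← hc, transpose_transpose]
  refine ⟨c, hRc, Algebra.leftMulMatrix_injective b ?_⟩
  have hU : IsUnit J := by
    rw [Matrix.isUnit_iff_isUnit_det]
    exact hJdet.isUnit
  apply hU.mul_left_cancel
  rw [← h₁, hc, hRc, ← mul_assoc, ← hJ, mul_assoc, mul_assoc, ← map_mul, ← map_mul]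
  congr 2
  ring

theorem congr_gram (hJ : ∀ x, J * μ x = (μ x)ᵀ * J) (c β : L) :
    (μ c)ᵀ * (J * μ β) * μ c = J * μ (c ^ 2 * β) := by
  rw [← mul_assoc, ← hJ, mul_assoc, mul_assoc, ← map_mul, ← map_mul]
  congr 2
  ring

theorem exists_gram_of_intertwine (hb : ∀ i, b i = θ ^ (i : ℕ)) (hJdet : J.det ≠ 0)
    (hJ : ∀ x, J * μ x = (μ x)ᵀ * J) {A B Q : Matrix (Fin n) (Fin n) K} (hA : A.IsSymm)
    (hB : B.IsSymm) (hQ : Q.det ≠ 0) (h : A * (Q * μ θ) = B * Q) :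
    ∃ (P : Matrix (Fin n) (Fin n) K) (β : L), P.det ≠ 0 ∧ A = P * (J * μ β) * Pᵀ ∧
      B = P * (J * μ (θ * β)) * Pᵀ := by
  have hQu : IsUnit Q.det := hQ.isUnit
  have hJu : IsUnit J.det := hJdet.isUnit
  have h₁ : Qᵀ * A * Q * μ θ = Qᵀ * B * Q := by
    simp only [mul_assoc, h]
  have h₂ : (μ θ)ᵀ * (Qᵀ * A * Q) = Qᵀ * B * Q := by
    have := congrArg transpose h₁
    simpa [Matrix.transpose_mul, hA.eq, hB.eq, mul_assoc] using this
  have hcomm : Commute (J⁻¹ * (Qᵀ * A * Q)) (μ θ) := by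
    have h₃ : J⁻¹ * (μ θ)ᵀ = μ θ * J⁻¹ := by
      rw [← Matrix.mul_nonsing_inv_cancel_right J (J⁻¹ * (μ θ)ᵀ) hJu, mul_assoc J⁻¹, ← hJ,
        Matrix.nonsing_inv_mul_cancel_left _ _ hJu]
    rw [Commute, SemiconjBy, mul_assoc, h₁, ← h₂, ← mul_assoc, h₃, mul_assoc]
  obtain ⟨β, hβ⟩ := exists_eq_leftMulMatrix_of_commute b θ hb hcomm
  have hJβ : J * μ β = Qᵀ * A * Q := by
    rw [← hβ, Matrix.mul_nonsing_inv_cancel_left _ _ hJu]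
  have hcancel (N : Matrix (Fin n) (Fin n) K) : N = (Q⁻¹)ᵀ * (Qᵀ * N * Q) * (Q⁻¹)ᵀᵀ := by
    rw [transpose_transpose, mul_assoc, Matrix.mul_nonsing_inv_cancel_right _ _ hQu, ← mul_assoc,
      ← Matrix.transpose_mul, Matrix.mul_nonsing_inv _ hQu, transpose_one, one_mul]
  refine ⟨(Q⁻¹)ᵀ, β, ?_, ?_, ?_⟩
  · rw [det_transpose]
    exact (Matrix.isUnit_nonsing_inv_det Q hQu).ne_zero
  · rw [hJβ]
    exact hcancel A
  · rw [mul_comm θ, map_mul, ← mul_assoc J, hJβ, h₁]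
    exact hcancel B

theorem det_pencil_gram (A : Matrix (Fin n) (Fin n) K) (T P : Matrix (Fin n) (Fin n) K) :
    ((X : K[X]) • (P * A * Pᵀ).map C - (P * (A * T) * Pᵀ).map C).det =
      C (P.det ^ 2 * A.det) * T.charpoly := by
  have h : (X : K[X]) • (P * A * Pᵀ).map C - (P * (A * T) * Pᵀ).map C =
      (P * A).map C * T.charmatrix * Pᵀ.map C := by
    rw [charmatrix, mul_sub, sub_mul, scalar_apply, ← smul_one_eq_diagonal]
    simp [Matrix.map_mul, mul_assoc]
  have hdet (N : Matrix (Fin n) (Fin n) K) : (N.map C).det = C N.det := (RingHom.map_det C N).symm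
  rw [h, det_mul, det_mul, hdet, hdet, charpoly, det_mul, det_transpose]
  simp only [map_mul, map_pow]
  ring

end Gram

theorem isUnit_of_norm_ne_zero {K L : Type*} [Field K] [CommRing L] [Algebra K L]
    [FiniteDimensional K L] {x : L} (hx : Algebra.norm K x ≠ 0) : IsUnit x := by
  rw [Algebra.norm_apply] at hx
  obtain ⟨y, hy⟩ := (LinearMap.equivOfDetNeZero _ hx).surjective 1
  exact IsUnit.of_mul_eq_one y hy

theorem Quot.nonempty_equiv_of_correspondence {α β : Type*} {r : α → α → Prop}
    {s : β → β → Prop} (R : α → β → Prop) (hs : ∀ b, s b b) (hleft : ∀ a, ∃ b, R a b)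
    (hright : ∀ b, ∃ a, R a b)
    (h : ∀ {a a' b b'}, R a b → R a' b' → (r a a' ↔ s b b')) :
    Nonempty (Quot r ≃ Quot s) := by
  choose F hF using hleft
  choose G hG using hright
  refine ⟨⟨Quot.map F fun a a' => (h (hF a) (hF a')).1, Quot.map G fun b b' => (h (hG b) (hG b')).2,
    ?_, ?_⟩⟩
  · rintro ⟨a⟩
    exact Quot.sound ((h (hG _) (hF a)).2 (hs _))
  · rintro ⟨b⟩
    exact Quot.sound ((h (hF _) (hG b)).1 ((h (hG b) (hG b)).2 (hs b)))

theorem coeff_fxOne_self {n : ℕ} {R : Type*} [CommRing R] (f : Fin (n + 1) → R) :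
    (fxOne f).coeff n = f 0 := by
  rw [fxOne, finsetSum_coeff, Finset.sum_eq_single 0]
  · simp
  · intro i _ hi
    have : (i : ℕ) ≠ 0 := fun h => hi (Fin.ext h)
    rw [coeff_C_mul_X_pow, if_neg (by omega)]
  · simp

theorem stmt1 (K : Type*) [Field K] (hchar : ringChar K ≠ 2) (n : ℕ) (hn : 3 ≤ n)
    (f : Fin (n+1) → K) (hf0 : f 0 ≠ 0)
    (hsep : (fxOne f).Separable) (hdeg : (fxOne f).natDegree = n) :
    Nonempty (Quot (orbitRel K f) ≃ Quot (pairRel K f)) := by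
  have hmonic : (C (f 0)⁻¹ * fxOne f).Monic := by
    rw [Monic, leadingCoeff_mul, leadingCoeff_C, leadingCoeff, hdeg, coeff_fxOne_self,
      inv_mul_cancel₀ hf0]
  have hndeg : (C (f 0)⁻¹ * fxOne f).natDegree = n := by
    rw [natDegree_C_mul (inv_ne_zero hf0), hdeg]
  have hfg : C (f 0) * (C (f 0)⁻¹ * fxOne f) = fxOne f := by
    rw [← mul_assoc, ← C_mul, mul_inv_cancel₀ hf0, C_1, one_mul]
  have hsq : Squarefree (C (f 0)⁻¹ * fxOne f) := fun x hx =>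
    hsep.squarefree x (hx.trans ((dvd_mul_left _ _).trans hfg.dvd))
  let pb := AdjoinRoot.powerBasis hmonic.ne_zero
  let b : Module.Basis (Fin n) K (Lf f) := pb.basis.reindex (finCongr hndeg)
  set θ : Lf f := AdjoinRoot.root _
  have hb (i : Fin n) : b i = θ ^ (i : ℕ) := by
    rw [Module.Basis.reindex_apply, pb.basis_eq_pow]
    rfl
  have : FiniteDimensional K (Lf f) := .of_basis b
  have hchθ : (Algebra.leftMulMatrix b θ).charpoly = C (f 0)⁻¹ * fxOne f := by
    refine Eq.trans ?_ ((charpoly_leftMulMatrix pb).trans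
      (AdjoinRoot.minpoly_powerBasis_gen_of_monic hmonic))
    rw [Algebra.leftMulMatrix_apply, Algebra.leftMulMatrix_apply, LinearMap.charpoly_toMatrix,
      LinearMap.charpoly_toMatrix]
    rfl
  obtain ⟨J, hJsymm, hJdet, hJ⟩ := exists_symm_gram (by omega) b θ hb
  set d : K := (-1) ^ (n * (n - 1) / 2) with hd
  have hdd : d * d = 1 := by rw [hd, ← mul_pow]; simp
  have hJ0 : J.det ≠ 0 := hJdet ▸ left_ne_zero_of_mul_eq_one hdd
  have hdC : (-1 : K[X]) ^ (n * (n - 1) / 2) = C d := by simp [hd]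
  have hnorm (x : Lf f) : (Algebra.leftMulMatrix b x).det = Algebra.norm K x :=
    (Algebra.norm_eq_matrix_det b x).symm
  have hnormC (c : K) (x : Lf f) : Algebra.norm K (c • x) = c ^ n * Algebra.norm K x := by
    rw [Algebra.smul_def, map_mul, Algebra.norm_algebraMap_of_basis b, Fintype.card_fin]
  have hpow : f 0 ^ n = f 0 ^ (n - 3) * f 0 ^ 3 := by rw [← pow_add]; congr 1; omega
  refine Quot.nonempty_equiv_of_correspondence (fun p a =>
    ∃ Q : Matrix (Fin n) (Fin n) K, Q.det * a.1.2 = f 0 ^ 2 ∧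
      p.1.1 = Q * (J * Algebra.leftMulMatrix b ((f 0)⁻¹ • a.1.1)) * Qᵀ ∧
      p.1.2 = Q * (J * Algebra.leftMulMatrix b (θ * ((f 0)⁻¹ • a.1.1))) * Qᵀ) ?_ ?_ ?_ ?_
  · exact fun a => ⟨1, isUnit_one, by simp, by simp⟩
  · rintro ⟨⟨A, B⟩, hA, hB, hAB⟩
    dsimp only at hA hB hAB ⊢
    rw [pencilDisc_eq_binForm_iff, hdC] at hAB
    have hdetA : d * A.det = f 0 := by
      have h := congrArg (fun p => p.coeff n) hAB
      have h2 := coeff_det_X_add_C_card A (-B)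
      rw [Fintype.card_fin] at h2
      have h3 : (-B).map C = -B.map (C : K → K[X]) := by ext1; simp
      rw [h3, ← sub_eq_add_neg] at h2
      simpa only [coeff_C_mul, h2, coeff_fxOne_self] using h
    have hA0 : A.det ≠ 0 := right_ne_zero_of_mul (hdetA ▸ hf0)
    have hAu : IsUnit A.det := hA0.isUnit
    have hT : (A⁻¹ * B).charpoly = C (f 0)⁻¹ * fxOne f := by
      have h := det_pencil_gram A (A⁻¹ * B) 1
      simp only [Matrix.mul_nonsing_inv_cancel_left _ _ hAu, one_mul, transpose_one, mul_one,
        det_one, one_pow] at h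
      rw [← hAB, h, ← mul_assoc, ← mul_assoc, ← C_mul, ← C_mul, mul_assoc, hdetA,
        inv_mul_cancel₀ hf0, C_1, one_mul]
    obtain ⟨Q, hQ, hQT⟩ := Matrix.exists_intertwine_adjoinRoot b hT hsq
    obtain ⟨P, β, hP, hPA, hPB⟩ := exists_gram_of_intertwine hb hJ0 hJ hA hB hQ (by
      rw [hQT, ← mul_assoc, Matrix.mul_nonsing_inv_cancel_left _ _ hAu])
    have hβ : P.det ^ 2 * Algebra.norm K β = f 0 := by
      refine Eq.trans ?_ hdetA
      rw [hPA, det_mul, det_mul, det_mul, det_transpose, hJdet, hnorm]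
      linear_combination (-P.det ^ 2 * Algebra.norm K β) * hdd
    have hα : (f 0)⁻¹ • (f 0 • β) = β := inv_smul_smul₀ hf0 β
    refine ⟨⟨(f 0 • β, f 0 ^ 2 / P.det), ?_, ?_, ?_⟩, P, ?_, ?_, ?_⟩
    · apply isUnit_of_norm_ne_zero (K := K)
      rw [hnormC]
      exact mul_ne_zero (pow_ne_zero _ hf0) (right_ne_zero_of_mul (hβ ▸ hf0))
    · exact div_ne_zero (pow_ne_zero _ hf0) hP
    · rw [hnormC, hpow]
      field_simp
      linear_combination hβ
    · exact mul_div_cancel₀ _ hP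
    · rw [hα, ← hPA]
    · rw [hα, ← hPB]
  · rintro ⟨⟨α, s⟩, hα, hs, hN⟩
    dsimp only at hα hs hN ⊢
    set β := (f 0)⁻¹ • α with hβ
    let Q : Matrix (Fin n) (Fin n) K := diagonal (Function.update 1 ⟨0, by omega⟩ (f 0 ^ 2 / s))
    have hQ : Q.det = f 0 ^ 2 / s := by
      rw [det_diagonal, Finset.prod_update_of_mem (Finset.mem_univ _)]
      simp
    have hsymm (x : Lf f) : (Q * (J * Algebra.leftMulMatrix b x) * Qᵀ).IsSymm := by
      simp only [IsSymm, transpose_mul, transpose_transpose, hJsymm, ← hJ, mul_assoc]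
    refine ⟨⟨(Q * (J * Algebra.leftMulMatrix b β) * Qᵀ,
      Q * (J * Algebra.leftMulMatrix b (θ * β)) * Qᵀ), hsymm _, hsymm _, ?_⟩, Q, ?_, rfl, rfl⟩
    · rw [pencilDisc_eq_binForm_iff, hdC, mul_comm θ, map_mul, ← mul_assoc J, det_pencil_gram, hchθ,
        ← mul_assoc, ← C_mul]
      convert hfg using 3
      rw [hQ, det_mul, hJdet, hnorm, hβ, hnormC, hN, inv_pow, hpow]
      field_simp
      linear_combination hdd
    · rw [hQ, div_mul_cancel₀ _ hs]
  · rintro ⟨⟨A, B⟩, _⟩ ⟨⟨A', B'⟩, _⟩ ⟨⟨α, s⟩, hα, hs, hN⟩ ⟨⟨α', s'⟩, hα', hs', hN'⟩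
      ⟨Q, hQ, hQA, hQB⟩ ⟨Q', hQ', hQA', hQB'⟩
    dsimp only at *
    have hf2 : f 0 ^ 2 ≠ 0 := pow_ne_zero _ hf0
    have hQ0 : Q.det ≠ 0 := left_ne_zero_of_mul (hQ ▸ hf2)
    have hQ0' : Q'.det ≠ 0 := left_ne_zero_of_mul (hQ' ▸ hf2)
    have hQu' : IsUnit Q'.det := hQ0'.isUnit
    have hQu : IsUnit Q.det := hQ0.isUnit
    constructor
    · rintro ⟨⟨γ, hγ⟩, hγA, hγB⟩
      dsimp only at hγA hγB
      have hcancel {M N : Matrix (Fin n) (Fin n) K}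
          (h : Q' * N * Q'ᵀ = γ * (Q * M * Qᵀ) * γᵀ) :
          (Q'⁻¹ * γ * Q) * M * (Q'⁻¹ * γ * Q)ᵀ = N := by
        have : (Q'⁻¹ * γ * Q) * M * (Q'⁻¹ * γ * Q)ᵀ =
            Q'⁻¹ * (γ * (Q * M * Qᵀ) * γᵀ) * (Q'⁻¹)ᵀ := by
          simp only [transpose_mul, mul_assoc]
        rw [this, ← h, mul_assoc Q', Matrix.nonsing_inv_mul_cancel_left _ _ hQu', mul_assoc,
          ← transpose_mul, Matrix.nonsing_inv_mul _ hQu', transpose_one, mul_one]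
      have hdetR : Q'.det * (Q'⁻¹ * γ * Q).det = Q.det := by
        rw [← det_mul, ← mul_assoc, Matrix.mul_nonsing_inv_cancel_left _ _ hQu', det_mul, hγ,
          one_mul]
      obtain ⟨c, hRc, hc⟩ := exists_sq_mul_eq_of_congr_gram hb hJ0 hJ
        (β := (f 0)⁻¹ • α) (β' := (f 0)⁻¹ • α') (R := Q'⁻¹ * γ * Q)
        (by
          rw [hnorm, hnormC]
          exact mul_ne_zero (pow_ne_zero _ (inv_ne_zero hf0)) (hα.map (Algebra.norm K)).ne_zero)
        (right_ne_zero_of_mul (hdetR ▸ hQ0))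
        (hcancel (by rw [← hQA', hγA, hQA])) (hcancel (by rw [← hQB', hγB, hQB]))
      rw [hRc, det_transpose, hnorm] at hdetR
      refine ⟨c, isUnit_of_norm_ne_zero (right_ne_zero_of_mul (hdetR ▸ hQ0)), ?_, ?_⟩
      · have := congrArg (f 0 • ·) hc
        simpa [mul_smul_comm, smul_inv_smul₀ hf0] using this
      · apply mul_left_cancel₀ hQ0'
        dsimp only
        rw [hQ', ← mul_assoc, hdetR, hQ]
    · rintro ⟨c, hc, hcα, hcs⟩
      dsimp only at hcα hcs
      subst hcα hcs
      have hdet : (Q' * (Algebra.leftMulMatrix b c)ᵀ * Q⁻¹).det = 1 := by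
        rw [det_mul, det_mul, det_transpose, hnorm, det_nonsing_inv, Ring.inverse_eq_inv',
          ← div_eq_mul_inv, div_eq_one_iff_eq hQ0]
        apply mul_right_cancel₀ hs
        rw [hQ, ← hQ', mul_assoc]
      have hkey (x : Lf f) : Q' * (J * Algebra.leftMulMatrix b (c ^ 2 * x)) * Q'ᵀ =
          (Q' * (Algebra.leftMulMatrix b c)ᵀ * Q⁻¹) * (Q * (J * Algebra.leftMulMatrix b x) * Qᵀ) *
            (Q' * (Algebra.leftMulMatrix b c)ᵀ * Q⁻¹)ᵀ := by
        rw [← congr_gram hJ, transpose_mul, transpose_mul, transpose_transpose]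
        have h1 : Qᵀ * (Q⁻¹)ᵀ = 1 := by
          rw [← transpose_mul, Matrix.nonsing_inv_mul _ hQu, transpose_one]
        simp only [mul_assoc, Matrix.nonsing_inv_mul_cancel_left _ _ hQu]
        simp only [← mul_assoc Qᵀ, h1, one_mul]
      refine ⟨⟨_, hdet⟩, ?_, ?_⟩
      · dsimp only
        rw [hQA', hQA, ← hkey, mul_smul_comm]
      · dsimp only
        rw [hQB', hQB, ← hkey]
        congr 4
        rw [← mul_smul_comm, mul_left_comm]
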